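/- arXiv:1307.5484 — 2 statements merged into one kernel-verified Lean document; each statement's English description precedes it below -/
import Mathlib

section
/- Let F be a subfield of ℝ closed under real square roots (√c ∈ F whenever 0 ≤ c ∈ F), let d ∈ F, and let W ∈ F[x,y] be a nonzero polynomial in two variables. Let (c_j)_{j∈ℕ} and (u_j)_{j∈ℕ} be sequences of real numbers such that: (i) each c_j is transcendental over F and d < c_j; (ii) each u_j ∈ Qclo(F(c_j)), i.e., u_j lies in the top field of some finite tower F(c_j) = K₀ ⊂ K₁ ⊂ ⋯ ⊂ K_m of subfields of ℝ in which each K_i is a quadratic extension of K_{i−1}; (iii) W(c_j, u_j) = 0 for all j; and (iv) lim_{j→∞} c_j = d and L = lim_{j→∞} u_j exists in ℝ. Then L ∈ F. -/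
open Filter

/-- The real quadratic closure of a subfield `K` of `ℝ`: the smallest subfield of `ℝ`
containing `K` that is closed under real square roots.  A real number belongs to
`Qclo K` exactly if it lies in the top of a finite tower of quadratic extensions
of `K` inside `ℝ`. -/
noncomputable def Qclo (K : Subfield ℝ) : Subfield ℝ :=
  sInf {M : Subfield ℝ | K ≤ M ∧ ∀ c : ℝ, c ∈ M → 0 ≤ c → Real.sqrt c ∈ M}

/-- `c` is transcendental over the subfield `F` of `ℝ`: it is a root of no nonzero
polynomial with coefficients in `F`. -/
def TranscOver (F : Subfield ℝ) (c : ℝ) : Prop :=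
  ∀ p : Polynomial ℝ, (∀ i, p.coeff i ∈ F) → Polynomial.eval c p = 0 → p = 0

namespace QuadraticClosureLimit

open Topology Polynomial

section Germs

variable {φ : Ultrafilter ℕ}

instance isAlgClosed_germ {α K : Type*} (φ : Ultrafilter α) [Field K] [IsAlgClosed K] :
    IsAlgClosed (Germ (φ : Filter α) K) := by
  refine IsAlgClosed.of_exists_root _ fun p hp hirr => ?_
  have hsurj : Function.Surjective (Germ.coeRingHom (R := K) (φ : Filter α)) :=
    Quot.mk_surjective
  obtain ⟨q, hqp, hdeg, hq⟩ := lifts_and_natDegree_eq_and_monic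
    ((mem_lifts (f := Germ.coeRingHom (R := K) (φ : Filter α)) p).2 (map_surjective _ hsurj p)) hp
  have hroot : ∀ m, ∃ x, (q.map (Pi.evalRingHom (fun _ : α => K) m)).eval x = 0 := by
    intro m
    refine IsAlgClosed.exists_root _ fun h0 => hirr.natDegree_pos.ne' ?_
    rw [← hdeg, ← hq.natDegree_map (Pi.evalRingHom (fun _ : α => K) m)]
    exact natDegree_eq_of_degree_eq_some h0
  choose r hr using hroot
  refine ⟨Germ.coeRingHom (φ : Filter α) r, ?_⟩
  have hz : q.eval r = 0 := by
    ext m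
    have h := hr m
    rw [eval_map, show r m = Pi.evalRingHom (fun _ : α => K) m r from rfl, eval₂_at_apply] at h
    exact h
  rw [← hqp, eval_map, eval₂_at_apply, hz, map_zero]

theorem Germ.tendsto_add {f g : Germ (φ : Filter ℕ) ℂ} {a b : ℂ}
    (hf : f.Tendsto (𝓝 a)) (hg : g.Tendsto (𝓝 b)) : (f + g).Tendsto (𝓝 (a + b)) := by
  induction f using Germ.inductionOn
  induction g using Germ.inductionOn
  exact Filter.Tendsto.add hf hg

theorem Germ.tendsto_mul {f g : Germ (φ : Filter ℕ) ℂ} {a b : ℂ}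
    (hf : f.Tendsto (𝓝 a)) (hg : g.Tendsto (𝓝 b)) : (f * g).Tendsto (𝓝 (a * b)) := by
  induction f using Germ.inductionOn
  induction g using Germ.inductionOn
  exact Filter.Tendsto.mul hf hg

theorem Germ.tendsto_const (a : ℂ) : (a : Germ (φ : Filter ℕ) ℂ).Tendsto (𝓝 a) :=
  tendsto_const_nhds

theorem Germ.tendsto_unique {f : Germ (φ : Filter ℕ) ℂ} {a b : ℂ}
    (hf : f.Tendsto (𝓝 a)) (hg : f.Tendsto (𝓝 b)) : a = b := by
  induction f using Germ.inductionOn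
  exact tendsto_nhds_unique (f := _) (l := (φ : Filter ℕ)) hf hg

/-- Germs along an ultrafilter with a finite limit form a valuation ring. -/
theorem Germ.exists_tendsto_or_inv (f : Germ (φ : Filter ℕ) ℂ) :
    (∃ a, f.Tendsto (𝓝 a)) ∨ ∃ a, f⁻¹.Tendsto (𝓝 a) := by
  have key : ∀ g : ℕ → ℂ, (∀ᶠ n in (φ : Filter ℕ), ‖g n‖ ≤ 1) →
      ∃ a, Tendsto g φ (𝓝 a) := by
    intro g hg
    obtain ⟨a, -, ha⟩ := (isCompact_closedBall (0 : ℂ) 1).ultrafilter_le_nhds (φ.map g) (by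
      rw [le_principal_iff]
      exact hg.mono fun n hn => mem_closedBall_zero_iff.2 hn)
    exact ⟨a, ha⟩
  induction f using Germ.inductionOn with | _ f =>
  rcases φ.em (fun n => ‖f n‖ ≤ 1) with h | h
  · exact Or.inl (key f h)
  · refine Or.inr (key f⁻¹ ?_)
    filter_upwards [h] with n hn
    rw [Pi.inv_apply, norm_inv]
    exact inv_le_one_of_one_le₀ (not_le.1 hn).le

/-- Every finite limit of a germ in `S` lies in `R`. -/
def LimitsIn (R : Subfield ℂ) (S : Subfield (Germ (φ : Filter ℕ) ℂ)) : Prop :=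
  ∀ g ∈ S, ∀ a, g.Tendsto (𝓝 a) → a ∈ R

theorem mem_of_quadratic {R : Subfield ℂ} (hR : ∀ w, w ^ 2 ∈ R → w ∈ R) {a b c z : ℂ}
    (ha : a ∈ R) (hb : b ∈ R) (hc : c ∈ R) (hne : a ≠ 0 ∨ b ≠ 0 ∨ c ≠ 0)
    (h : a * z ^ 2 + b * z + c = 0) : z ∈ R := by
  by_cases ha0 : a = 0
  · by_cases hb0 : b = 0
    · simp_all
    · have : z = -c / b := by
        field_simp
        linear_combination h - z ^ 2 * ha0
      rw [this]
      exact div_mem (neg_mem hc) hb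
  · have hw : 2 * a * z + b ∈ R := by
      refine hR _ ?_
      have : (2 * a * z + b) ^ 2 = b ^ 2 - 4 * a * c := by linear_combination 4 * a * h
      rw [this]
      exact sub_mem (pow_mem hb 2) (mul_mem (mul_mem (ofNat_mem R 4) ha) hc)
    have : z = ((2 * a * z + b) - b) / (2 * a) := by field_simp; ring
    rw [this]
    exact div_mem (sub_mem hw hb) (mul_mem (ofNat_mem R 2) ha)

theorem LimitsIn.mem_of_quadratic {R : Subfield ℂ} (hR : ∀ w, w ^ 2 ∈ R → w ∈ R)
    {S : Subfield (Germ (φ : Filter ℕ) ℂ)} (hS : LimitsIn R S)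
    {b c z : Germ (φ : Filter ℕ) ℂ} (hb : b ∈ S) (hc : c ∈ S)
    (h : z ^ 2 + b * z + c = 0) {L : ℂ} (hL : z.Tendsto (𝓝 L)) : L ∈ R := by
  have lim : ∀ {A B C : Germ (φ : Filter ℕ) ℂ}, A ∈ S → B ∈ S → C ∈ S →
      A * z ^ 2 + B * z + C = 0 → ∀ {x y w : ℂ}, A.Tendsto (𝓝 x) → B.Tendsto (𝓝 y) →
      C.Tendsto (𝓝 w) → (x ≠ 0 ∨ y ≠ 0 ∨ w ≠ 0) → L ∈ R := by
    intro A B C hA hB hC h0 x y w hx hy hw hne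
    refine QuadraticClosureLimit.mem_of_quadratic hR (hS _ hA _ hx) (hS _ hB _ hy)
      (hS _ hC _ hw) hne ?_
    have h1 := Germ.tendsto_add (Germ.tendsto_add (Germ.tendsto_mul hx
      (Germ.tendsto_mul hL hL)) (Germ.tendsto_mul hy hL)) hw
    rw [← sq, ← sq, h0] at h1
    exact Germ.tendsto_unique h1 (Germ.tendsto_const 0)
  have h1 : (1 : Germ (φ : Filter ℕ) ℂ).Tendsto (𝓝 1) := Germ.tendsto_const 1
  have hcase : ∀ {x y : Germ (φ : Filter ℕ) ℂ},
      (∃ a, x.Tendsto (𝓝 a)) → (∃ a, (y / x).Tendsto (𝓝 a)) → x ≠ 0 →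
      (∃ a, x.Tendsto (𝓝 a)) ∧ ∃ a, y.Tendsto (𝓝 a) := by
    rintro x y ⟨a, ha⟩ ⟨e, he⟩ hx
    refine ⟨⟨a, ha⟩, e * a, ?_⟩
    have := Germ.tendsto_mul he ha
    rwa [div_mul_cancel₀ _ hx] at this
  by_cases hc0 : c = 0
  · have hz : z * (z + b) = 0 := by rw [hc0] at h; linear_combination h
    rcases mul_eq_zero.1 hz with h | h
    · exact hS z (h ▸ zero_mem S) _ hL
    · exact hS z (eq_neg_of_add_eq_zero_left h ▸ neg_mem hb) _ hL
  by_cases hb0 : b = 0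
  · subst hb0
    rcases Germ.exists_tendsto_or_inv c with ⟨y, hy⟩ | ⟨y, hy⟩
    · exact lim (one_mem S) (zero_mem S) hc (by linear_combination h) h1
        (Germ.tendsto_const 0) hy (by simp)
    · refine lim (inv_mem hc) (zero_mem S) (one_mem S) ?_ hy (Germ.tendsto_const 0) h1 (by simp)
      field_simp
      linear_combination h
  rcases Germ.exists_tendsto_or_inv (b / c) with ⟨e, he⟩ | ⟨e, he⟩
  · rcases Germ.exists_tendsto_or_inv c with hy | ⟨y, hy⟩
    · obtain ⟨⟨x, hx⟩, y, hy⟩ := hcase hy ⟨e, he⟩ hc0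
      exact lim (one_mem S) hb hc (by linear_combination h) h1 hy hx (by simp)
    · refine lim (inv_mem hc) (div_mem hb hc) (one_mem S) ?_ hy he h1 (by simp)
      field_simp
      linear_combination h
  · rw [inv_div] at he
    rcases Germ.exists_tendsto_or_inv b with hy | ⟨y, hy⟩
    · obtain ⟨⟨x, hx⟩, y, hy⟩ := hcase hy ⟨e, he⟩ hb0
      exact lim (one_mem S) hb hc (by linear_combination h) h1 hx hy (by simp)
    · refine lim (inv_mem hb) (one_mem S) (div_mem hc hb) ?_ hy h1 he (by simp)
      field_simp
      linear_combination h

theorem exists_eq_add_mul_of_mem_closure {K : Type*} [Field K] {S : Subfield K} {s : K}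
    (hs : s ^ 2 ∈ S) {x : K} (hx : x ∈ Subfield.closure (insert s (S : Set K))) :
    ∃ p ∈ S, ∃ q ∈ S, x = p + q * s := by
  by_cases hsS : s ∈ S
  · refine ⟨x, Subfield.closure_le.2 (Set.insert_subset hsS subset_rfl) hx, 0, zero_mem S, ?_⟩
    simp
  induction hx using Subfield.closure_induction with
  | mem x hx =>
    rcases hx with rfl | hx
    · exact ⟨0, zero_mem S, 1, one_mem S, by simp⟩
    · exact ⟨x, hx, 0, zero_mem S, by simp⟩
  | one => exact ⟨1, one_mem S, 0, zero_mem S, by simp⟩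
  | add x y _ _ hx hy =>
    obtain ⟨p, hp, q, hq, rfl⟩ := hx
    obtain ⟨p', hp', q', hq', rfl⟩ := hy
    exact ⟨p + p', add_mem hp hp', q + q', add_mem hq hq', by ring⟩
  | neg x _ hx =>
    obtain ⟨p, hp, q, hq, rfl⟩ := hx
    exact ⟨-p, neg_mem hp, -q, neg_mem hq, by ring⟩
  | mul x y _ _ hx hy =>
    obtain ⟨p, hp, q, hq, rfl⟩ := hx
    obtain ⟨p', hp', q', hq', rfl⟩ := hy
    exact ⟨p * p' + q * q' * s ^ 2,
      add_mem (mul_mem hp hp') (mul_mem (mul_mem hq hq') hs),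
      p * q' + q * p', add_mem (mul_mem hp hq') (mul_mem hq hp'), by ring⟩
  | inv x _ hx =>
    obtain ⟨p, hp, q, hq, rfl⟩ := hx
    by_cases hq0 : q = 0
    · exact ⟨p⁻¹, inv_mem hp, 0, zero_mem S, by simp [hq0]⟩
    have hmem : p ^ 2 - q ^ 2 * s ^ 2 ∈ S := sub_mem (pow_mem hp 2) (mul_mem (pow_mem hq 2) hs)
    have h1 : p + q * s ≠ 0 := fun h => hsS (by
      have : s = -p / q := by field_simp; linear_combination h
      exact this ▸ div_mem (neg_mem hp) hq)
    have h2 : p - q * s ≠ 0 := fun h => hsS (by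
      have : s = p / q := by field_simp; linear_combination -h
      exact this ▸ div_mem hp hq)
    refine ⟨p / (p ^ 2 - q ^ 2 * s ^ 2), div_mem hp hmem,
      -q / (p ^ 2 - q ^ 2 * s ^ 2), div_mem (neg_mem hq) hmem, ?_⟩
    rw [show p ^ 2 - q ^ 2 * s ^ 2 = (p + q * s) * (p - q * s) by ring]
    field_simp
    ring

theorem LimitsIn.exists_sqrt_closed {R : Subfield ℂ} (hR : ∀ w, w ^ 2 ∈ R → w ∈ R)
    {S : Subfield (Germ (φ : Filter ℕ) ℂ)} (hS : LimitsIn R S) :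
    ∃ M, S ≤ M ∧ LimitsIn R M ∧ ∀ s, s ^ 2 ∈ M → s ∈ M := by
  obtain ⟨M, hSM, hM⟩ := zorn_le_nonempty₀ {M | LimitsIn R M} (by
    intro C hC hchain y hy
    refine ⟨sSup C, fun g hg a ha => ?_, fun z hz => le_sSup hz⟩
    obtain ⟨N, hN, hgN⟩ := (Subfield.mem_sSup_of_directedOn ⟨y, hy⟩ hchain.directedOn).1 hg
    exact hC hN g hgN a ha) S hS
  refine ⟨M, hSM, hM.prop, fun s hs => ?_⟩
  have hle : M ≤ Subfield.closure (insert s (M : Set _)) := fun x hx =>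
    Subfield.subset_closure (Set.mem_insert_of_mem _ hx)
  refine hM.le_of_ge (fun g hg a ha => ?_) hle (Subfield.subset_closure (Set.mem_insert _ _))
  obtain ⟨p, hp, q, hq, rfl⟩ := exists_eq_add_mul_of_mem_closure hs hg
  exact LimitsIn.mem_of_quadratic hR hM.prop (b := -(2 * p)) (c := p ^ 2 - q ^ 2 * s ^ 2)
    (neg_mem (mul_mem (ofNat_mem M 2) hp))
    (sub_mem (pow_mem hp 2) (mul_mem (pow_mem hq 2) hs)) (by ring) ha

end Germs

/-- The subfield `F(i)` of `ℂ`. -/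
def complexify (F : Subfield ℝ) : Subfield ℂ where
  carrier := {z | z.re ∈ F ∧ z.im ∈ F}
  zero_mem' := ⟨zero_mem F, zero_mem F⟩
  one_mem' := ⟨one_mem F, zero_mem F⟩
  add_mem' hx hy := ⟨add_mem hx.1 hy.1, add_mem hx.2 hy.2⟩
  neg_mem' hx := ⟨neg_mem hx.1, neg_mem hx.2⟩
  mul_mem' hx hy := ⟨sub_mem (mul_mem hx.1 hy.1) (mul_mem hx.2 hy.2),
    add_mem (mul_mem hx.1 hy.2) (mul_mem hx.2 hy.1)⟩
  inv_mem' z hz := by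
    have : Complex.normSq z ∈ F := by
      rw [Complex.normSq_apply]
      exact add_mem (mul_mem hz.1 hz.1) (mul_mem hz.2 hz.2)
    simp only [Set.mem_ofPred_eq, Complex.inv_re, Complex.inv_im]
    exact ⟨div_mem hz.1 this, div_mem (neg_mem hz.2) this⟩

theorem mem_complexify_of_sq_mem {F : Subfield ℝ} (hF : ∀ x : ℝ, x ∈ F → 0 ≤ x → √x ∈ F)
    (w : ℂ) (hw : w ^ 2 ∈ complexify F) : w ∈ complexify F := by
  obtain ⟨hre, him⟩ := hw
  have hsq : ∀ x : ℝ, x ^ 2 ∈ F → x ∈ F := by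
    intro x hx
    have h := hF _ hx (sq_nonneg x)
    rw [Real.sqrt_sq_eq_abs] at h
    rcases abs_choice x with h' | h' <;> rw [h'] at h
    · exact h
    · simpa using neg_mem h
  have hn : w.re ^ 2 + w.im ^ 2 ∈ F := by
    refine hsq _ ?_
    have : (w.re ^ 2 + w.im ^ 2) ^ 2 = (w ^ 2).re ^ 2 + (w ^ 2).im ^ 2 := by
      simp only [sq, Complex.mul_re, Complex.mul_im]
      ring
    rw [this]
    exact add_mem (pow_mem hre 2) (pow_mem him 2)
  have h2 : (2 : ℝ) ∈ F := ofNat_mem F 2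
  refine ⟨hsq _ ?_, hsq _ ?_⟩
  · have : w.re ^ 2 = (w.re ^ 2 + w.im ^ 2 + (w ^ 2).re) / 2 := by
      simp only [sq, Complex.mul_re]
      ring
    exact this ▸ div_mem (add_mem hn hre) h2
  · have : w.im ^ 2 = (w.re ^ 2 + w.im ^ 2 - (w ^ 2).re) / 2 := by
      simp only [sq, Complex.mul_re]
      ring
    exact this ▸ div_mem (sub_mem hn hre) h2

theorem exists_algHom_algebraicClosure {k Ω G : Type*} [Field k] [Field Ω] [Field G]
    [IsAlgClosed G] [Algebra k Ω] [Algebra k G] {x : Ω} {u : G} (hu : IsAlgebraic k u)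
    (hx : aeval x (minpoly k u) = 0) :
    ∃ (σ : algebraicClosure k Ω →ₐ[k] G) (y : algebraicClosure k Ω), (y : Ω) = x ∧ σ y = u := by
  have hxa : IsAlgebraic k x := ⟨_, minpoly.ne_zero hu.isIntegral, hx⟩
  let y : algebraicClosure k Ω := ⟨x, mem_algebraicClosure_iff.2 hxa⟩
  have hmin : minpoly k y = minpoly k u := by
    rw [minpoly.eq_of_irreducible_of_monic (minpoly.irreducible hu.isIntegral) hx
      (minpoly.monic hu.isIntegral)]
    exact (minpoly.algebraMap_eq (algebraMap (algebraicClosure k Ω) Ω).injective y).symm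
  obtain ⟨σ, hσ⟩ := IntermediateField.exists_algHom_of_splits_of_aeval (F := k) (K := G)
    (E := algebraicClosure k Ω) (x := y) (y := u)
    (fun s => ⟨Algebra.IsIntegral.isIntegral s, IsAlgClosed.splits _⟩)
    (by rw [hmin]; exact minpoly.aeval k u)
  exact ⟨σ, y, rfl, hσ⟩

/-- An algebraic hom out of `algebraicClosure k ℂ` sends the real quadratic closure of a subfield
`K` of `ℝ` into any square-root-closed subfield containing the image of `K`. -/
theorem map_mem_of_mem_Qclo {k G : Type*} [Field k] [Field G] [Algebra k ℂ] [Algebra k G]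
    (σ : algebraicClosure k ℂ →ₐ[k] G) {M : Subfield G} (hM : ∀ s, s ^ 2 ∈ M → s ∈ M)
    (hkM : ∀ a, algebraMap k G a ∈ M) {K : Subfield ℝ}
    (hK : ∀ x ∈ K, (x : ℂ) ∈ (algebraMap k ℂ).fieldRange)
    {x : ℝ} (hx : x ∈ Qclo K) {y : algebraicClosure k ℂ} (hy : (y : ℂ) = x) : σ y ∈ M := by
  let N : Subfield ℝ := (((M.comap σ.toRingHom).map
    (algebraMap (algebraicClosure k ℂ) ℂ)).comap Complex.ofRealHom)
  have hN : ∀ z : ℝ, z ∈ N ↔ ∃ e : algebraicClosure k ℂ, σ e ∈ M ∧ (e : ℂ) = z := fun z => Iff.rfl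
  have hxN : x ∈ N := by
    refine Subfield.mem_sInf.1 hx N ⟨fun z hz => ?_, fun z hz hz0 => ?_⟩
    · obtain ⟨a, ha⟩ := hK z hz
      exact (hN z).2 ⟨algebraMap k _ a, by simpa using hkM a, ha⟩
    · obtain ⟨e, he, hez⟩ := (hN z).1 hz
      have hsq : ((√z : ℝ) : ℂ) ^ 2 = e := by
        rw [hez, ← Complex.ofReal_pow, Real.sq_sqrt hz0]
      have halg : IsAlgebraic k ((√z : ℝ) : ℂ) :=
        IsAlgebraic.of_pow two_pos (hsq ▸ mem_algebraicClosure_iff.1 e.2)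
      refine (hN _).2 ⟨⟨_, mem_algebraicClosure_iff.2 halg⟩, hM _ ?_, rfl⟩
      rw [← map_pow]
      convert he
      exact Subtype.ext hsq
  obtain ⟨e, he, hex⟩ := (hN x).1 hxN
  rwa [show y = e from Subtype.ext (hy.trans hex.symm)]

theorem limitsIn_fieldRange_ratFunc {φ : Ultrafilter ℕ} {F : Subfield ℝ} (d : F)
    (ρ : RatFunc F →+* Germ (φ : Filter ℕ) ℂ)
    (hρ : ∀ p : F[X], (ρ (algebraMap F[X] (RatFunc F) p)).Tendsto (𝓝 (((p.eval d : F) : ℝ) : ℂ))) :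
    LimitsIn (complexify F) ρ.fieldRange := by
  rintro _ ⟨r, rfl⟩ a ha
  have hmem : ∀ x : F, ((x : ℝ) : ℂ) ∈ complexify F := fun x =>
    ⟨x.2, by simp⟩
  have hr : ρ r * ρ (algebraMap F[X] (RatFunc F) r.denom) =
      ρ (algebraMap F[X] (RatFunc F) r.num) := by
    rw [← map_mul]
    congr 1
    nth_rw 1 [← r.num_div_denom]
    exact div_mul_cancel₀ _ (RatFunc.algebraMap_ne_zero r.denom_ne_zero)
  have h := Germ.tendsto_mul ha (hρ r.denom)
  rw [hr] at h
  have heq := Germ.tendsto_unique h (hρ r.num)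
  have hden : r.denom.eval d ≠ 0 := by
    intro h0
    rw [h0] at heq
    have hnum : r.num.eval d = 0 := by
      have : (((r.num.eval d : F) : ℝ) : ℂ) = 0 := by rw [← heq]; simp
      exact_mod_cast this
    obtain ⟨x, y, hxy⟩ := r.isCoprime_num_denom
    simpa [h0, hnum] using congrArg (eval d) hxy
  have hden' : (((r.denom.eval d : F) : ℝ) : ℂ) ≠ 0 := by exact_mod_cast hden
  exact eq_div_of_mul_eq hden' heq ▸ div_mem (hmem _) (hmem _)

theorem eval₂_germ_eq_zero_iff {φ : Ultrafilter ℕ} {k : Type*} [Field k] (ρ : ℕ → k →+* ℂ)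
    (u : ℕ → ℂ) (P : k[X]) :
    P.eval₂ ((Germ.coeRingHom (φ : Filter ℕ)).comp (RingHom.pi ρ))
      (Germ.coeRingHom (φ : Filter ℕ) u) = 0 ↔
        ∀ᶠ j in (φ : Filter ℕ), P.eval₂ (ρ j) (u j) = 0 := by
  have h : ∀ j, (P.eval₂ (RingHom.pi ρ) u) j = P.eval₂ (ρ j) (u j) := fun j =>
    hom_eval₂ P (RingHom.pi ρ) (Pi.evalRingHom (fun _ : ℕ => ℂ) j) u
  rw [← hom_eval₂]
  simp_rw [← h]
  exact Germ.coe_eq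

theorem eval₂_equivMvPolynomial_symm {F : Subfield ℝ} (V : MvPolynomial (Fin 2) F) (c u : ℝ) :
    ((Bivariate.equivMvPolynomial F).symm V).eval₂
      (Complex.ofRealHom.comp (eval₂RingHom F.subtype c)) (u : ℂ) =
        (MvPolynomial.eval ![c, u] (V.map F.subtype) : ℝ) := by
  have h : ((eval₂RingHom (Complex.ofRealHom.comp (eval₂RingHom F.subtype c)) (u : ℂ)).comp
      (Bivariate.equivMvPolynomial F).symm.toRingEquiv.toRingHom) =
      Complex.ofRealHom.comp ((MvPolynomial.eval ![c, u]).comp (MvPolynomial.map F.subtype)) := by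
    ext i
    · simp
    · fin_cases i <;> simp
  exact RingHom.congr_fun h V

end QuadraticClosureLimit

open QuadraticClosureLimit Polynomial in
/-- Let `F ⊆ ℝ` be a subfield closed under real square roots, `d ∈ F`, and `W` a nonzero
two-variable polynomial with coefficients in `F`.  If `(c_j)` are transcendental over
`F` with `d < c_j`, each `u_j` is real quadratic over `F(c_j)`, `W(c_j, u_j) = 0`,
`c_j → d` and `u_j → L`, then `L ∈ F`. -/
theorem statement15 (F : Subfield ℝ)
    (hF : ∀ x : ℝ, x ∈ F → 0 ≤ x → Real.sqrt x ∈ F)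
    (d : ℝ) (hd : d ∈ F)
    (W : MvPolynomial (Fin 2) ℝ) (hW0 : W ≠ 0)
    (hWc : ∀ mo : Fin 2 →₀ ℕ, MvPolynomial.coeff mo W ∈ F)
    (c u : ℕ → ℝ) (L : ℝ)
    (htr : ∀ j, TranscOver F (c j)) (hdc : ∀ j, d < c j)
    (hu : ∀ j, u j ∈ Qclo (Subfield.closure (insert (c j) (F : Set ℝ))))
    (hroot : ∀ j, MvPolynomial.eval ![c j, u j] W = 0)
    (hclim : Tendsto c atTop (nhds d))
    (hulim : Tendsto u atTop (nhds L)) :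
    L ∈ F := by
  have hinj : ∀ j, Function.Injective
      (Complex.ofRealHom.comp (eval₂RingHom F.subtype (c j))) := by
    intro j
    rw [injective_iff_map_eq_zero]
    intro p hp
    have h0 : p.eval₂ F.subtype (c j) = 0 := Complex.ofReal_eq_zero.1 hp
    have := htr j (p.map F.subtype) (fun i => by simp) (by rw [eval_map, h0])
    exact (Polynomial.map_eq_zero _).1 this
  let ρ : ℕ → RatFunc F →+* ℂ := fun j => IsFractionRing.lift (hinj j)
  have hρ : ∀ j p, ρ j (algebraMap F[X] (RatFunc F) p) = (p.eval₂ F.subtype (c j) : ℝ) :=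
    fun j p => IsFractionRing.lift_algebraMap (hinj j) p
  let φ : Ultrafilter ℕ := hyperfilter ℕ
  have hφ : (φ : Filter ℕ) ≤ atTop := Nat.hyperfilter_le_atTop
  let r := (Germ.coeRingHom (R := ℂ) (φ : Filter ℕ)).comp (RingHom.pi ρ)
  let v : ℕ → ℂ := fun j => u j
  let U : Germ (φ : Filter ℕ) ℂ := Germ.coeRingHom (φ : Filter ℕ) v
  let _ : Algebra (RatFunc F) (Germ (φ : Filter ℕ) ℂ) := r.toAlgebra
  have hU : IsAlgebraic (RatFunc F) U := by
    obtain ⟨V, rfl⟩ : W ∈ (MvPolynomial.map F.subtype).range := by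
      rw [RingHom.mem_range, ← Set.mem_range, MvPolynomial.mem_range_map_iff_coeffs_subset]
      intro x hx
      obtain ⟨m, -, rfl⟩ := MvPolynomial.mem_coeffs_iff.1 hx
      exact ⟨⟨_, hWc m⟩, rfl⟩
    refine ⟨((Polynomial.Bivariate.equivMvPolynomial F).symm V).map
      (algebraMap F[X] (RatFunc F)), ?_, ?_⟩
    · rw [Ne, Polynomial.map_eq_zero_iff (IsFractionRing.injective F[X] (RatFunc F)),
        EmbeddingLike.map_eq_zero_iff]
      rintro rfl
      exact hW0 (map_zero _)
    · refine (eval₂_germ_eq_zero_iff ρ v _).2 (Eventually.of_forall fun j => ?_)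
      have hcomp : (ρ j).comp (algebraMap F[X] (RatFunc F)) =
        Complex.ofRealHom.comp (eval₂RingHom F.subtype (c j)) := RingHom.ext (hρ j)
      rw [eval₂_map, hcomp, eval₂_equivMvPolynomial_symm, hroot j, Complex.ofReal_zero]
  obtain ⟨j, hj⟩ := ((eval₂_germ_eq_zero_iff ρ v _).1 (minpoly.aeval (RatFunc F) U)).exists
  let _ : Algebra (RatFunc F) ℂ := (ρ j).toAlgebra
  obtain ⟨σ, y, hy, hσ⟩ := exists_algHom_algebraicClosure hU (Ω := ℂ) (x := v j) hj
  have hbase : LimitsIn (complexify F) r.fieldRange := by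
    refine limitsIn_fieldRange_ratFunc ⟨d, hd⟩ r fun p => ?_
    have hlim : Tendsto (fun j => ((p.eval₂ F.subtype (c j) : ℝ) : ℂ)) atTop
        (nhds ((p.eval₂ F.subtype d : ℝ) : ℂ)) := by
      refine (Complex.continuous_ofReal.tendsto _).comp ?_
      simp_rw [← eval_map]
      exact ((p.map F.subtype).continuous.tendsto d).comp hclim
    have hd' : ((p.eval ⟨d, hd⟩ : F) : ℝ) = p.eval₂ F.subtype d :=
      (eval₂_at_apply F.subtype (⟨d, hd⟩ : F)).symm
    rw [hd']
    exact Tendsto.congr (fun j => (hρ j p).symm) (hlim.mono_left hφ)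
  obtain ⟨M, hrM, hlimM, hM⟩ := hbase.exists_sqrt_closed (mem_complexify_of_sq_mem hF)
  have hUM : U ∈ M := by
    rw [← hσ]
    refine map_mem_of_mem_Qclo σ hM (fun a => hrM ⟨a, rfl⟩) (fun x hx => ?_) (hu j) hy
    have hle : Subfield.closure (insert (c j) (F : Set ℝ)) ≤
        (ρ j).fieldRange.comap Complex.ofRealHom := by
      refine Subfield.closure_le.2 (Set.insert_subset ?_ fun a ha => ?_)
      · exact ⟨algebraMap F[X] _ X, by rw [hρ, eval₂_X]; rfl⟩
      · exact ⟨algebraMap F[X] _ (C ⟨a, ha⟩), by rw [hρ, eval₂_C]; rfl⟩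
    exact hle hx
  exact (hlimM U hUM L (((Complex.continuous_ofReal.tendsto L).comp hulim).mono_left hφ)).1
end

section
/- Let d₁, d₂, d₃, d₄ be positive real numbers, let u > 0, and let α₁, α₂, α₃, α₄ ∈ (0, π/2) satisfy α₁ + α₂ + α₃ + α₄ = π and cos α_i = d_i·u for i = 1, 2, 3, 4. Then u belongs to Qclo(ℚ(d₁, d₂, d₃, d₄)). (This expresses that a cyclic quadrilateral is constructible with straightedge and compass from the four distances d₁, …, d₄ of its sides from the circumcenter.) -/
open Real

/-- The cosines of four angles with sum `π` satisfy a polynomial relation. -/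
lemma cos_relation_of_sum_eq_pi {a b c d : ℝ} (h : a + b + c + d = π) :
    (2 * (cos a * cos b * cos c * cos d) + cos a ^ 2 + cos b ^ 2 + cos c ^ 2 + cos d ^ 2 - 2) ^ 2 =
      4 * ((1 - cos a ^ 2) * (1 - cos b ^ 2) * (1 - cos c ^ 2) * (1 - cos d ^ 2)) := by
  have hcos : cos a * cos b + cos c * cos d = sin a * sin b + sin c * sin d := by
    have key : cos (a + b) = -cos (c + d) := by
      rw [← cos_pi_sub]
      congr 1
      linarith
    rw [cos_add, cos_add] at key
    linarith
  have hprod : 2 * (cos a * cos b * cos c * cos d) + cos a ^ 2 + cos b ^ 2 + cos c ^ 2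
      + cos d ^ 2 - 2 = 2 * (sin a * sin b * sin c * sin d) := by
    have hsq : (cos a * cos b + cos c * cos d) ^ 2 = sin a ^ 2 * sin b ^ 2
        + sin c ^ 2 * sin d ^ 2 + 2 * (sin a * sin b * sin c * sin d) := by
      rw [hcos]
      ring
    simp only [sin_sq] at hsq
    linarith
  rw [hprod, ← sin_sq, ← sin_sq, ← sin_sq, ← sin_sq]
  ring

lemma le_Qclo (K : Subfield ℝ) : K ≤ Qclo K :=
  le_sInf fun _ hM => hM.1

lemma sqrt_mem_Qclo {K : Subfield ℝ} {c : ℝ} (hc : c ∈ Qclo K) (h0 : 0 ≤ c) :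
    √c ∈ Qclo K :=
  Subfield.mem_sInf.2 fun M hM => hM.2 c (Subfield.mem_sInf.1 hc M hM) h0

/-- If `d₁, d₂, d₃, d₄ > 0`, `u > 0` and `α₁, …, α₄ ∈ (0, π/2)` satisfy
`α₁ + α₂ + α₃ + α₄ = π` and `cos αᵢ = dᵢ·u`, then `u ∈ Qclo(ℚ(d₁,d₂,d₃,d₄))`;
i.e., a cyclic quadrilateral is constructible from the distances of its sides
from the circumcenter. -/
theorem statement19 (d₁ d₂ d₃ d₄ u α₁ α₂ α₃ α₄ : ℝ)
    (hd₁ : 0 < d₁) (hd₂ : 0 < d₂) (hd₃ : 0 < d₃) (hd₄ : 0 < d₄) (hu : 0 < u)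
    (h1 : α₁ ∈ Set.Ioo 0 (π / 2)) (h2 : α₂ ∈ Set.Ioo 0 (π / 2))
    (h3 : α₃ ∈ Set.Ioo 0 (π / 2)) (h4 : α₄ ∈ Set.Ioo 0 (π / 2))
    (hsum : α₁ + α₂ + α₃ + α₄ = π)
    (hc1 : Real.cos α₁ = d₁ * u) (hc2 : Real.cos α₂ = d₂ * u)
    (hc3 : Real.cos α₃ = d₃ * u) (hc4 : Real.cos α₄ = d₄ * u) :
    u ∈ Qclo (Subfield.closure {d₁, d₂, d₃, d₄}) := by
  obtain ⟨K, hK⟩ : ∃ K, K = Subfield.closure {d₁, d₂, d₃, d₄} := ⟨_, rfl⟩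
  rw [← hK]
  have m₁ : d₁ ∈ K := hK ▸ Subfield.subset_closure (by simp)
  have m₂ : d₂ ∈ K := hK ▸ Subfield.subset_closure (by simp)
  have m₃ : d₃ ∈ K := hK ▸ Subfield.subset_closure (by simp)
  have m₄ : d₄ ∈ K := hK ▸ Subfield.subset_closure (by simp)
  have hrel := cos_relation_of_sum_eq_pi hsum
  rw [hc1, hc2, hc3, hc4] at hrel
  let A : ℝ := 4 * ((d₁ * d₂ + d₃ * d₄) * (d₁ * d₃ + d₂ * d₄) * (d₁ * d₄ + d₂ * d₃))
  let B : ℝ := 4 * (d₁ ^ 2 * d₂ ^ 2 + d₁ ^ 2 * d₃ ^ 2 + d₁ ^ 2 * d₄ ^ 2 + d₂ ^ 2 * d₃ ^ 2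
    + d₂ ^ 2 * d₄ ^ 2 + d₃ ^ 2 * d₄ ^ 2) + 8 * (d₁ * d₂ * d₃ * d₄)
    - (d₁ ^ 2 + d₂ ^ 2 + d₃ ^ 2 + d₄ ^ 2) ^ 2
  have hA : A ≠ 0 := by positivity
  have hAB : u ^ 2 * A = B :=
    mul_left_cancel₀ (pow_ne_zero 4 hu.ne') (by simp only [A, B]; linear_combination hrel)
  have m_four : (4 : ℝ) ∈ K := ofNat_mem K 4
  have m_eight : (8 : ℝ) ∈ K := ofNat_mem K 8
  have mA : A ∈ K := by
    simp only [A]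
    apply_rules [mul_mem, add_mem]
  have mB : B ∈ K := by
    simp only [B]
    refine sub_mem ?_ (pow_mem ?_ 2) <;> apply_rules [pow_mem, mul_mem, add_mem]
  have mu : u ^ 2 ∈ K := by
    rw [eq_div_of_mul_eq hA hAB]
    exact div_mem mB mA
  rw [← sqrt_sq hu.le]
  exact sqrt_mem_Qclo (le_Qclo K mu) (sq_nonneg u)
end
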